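/- Let q > 0 be real, ξ ∈ ℂ, and for c ∈ ℝ ∖ ℤ define J(c) = −e^{iπ/4} ∫_{-∞}^{∞} e^{iπ q (x(t) − ξ)²} / (1 − e^{-2πi x(t)}) dt, where x(t) = c + e^{iπ/4} t. Then for any c₁ ∈ (−1,0) and c₂ ∈ (0,1), J(c₁) = J(c₂) + e^{iπ q ξ²}. -/

import Mathlib

open Real Set
open Complex (I)

/-- The contour integral
`J(c) = -e^{iπ/4} ∫_ℝ e^{iπq(x(t)-ξ)²}/(1 - e^{-2πix(t)}) dt`
along the line `x(t) = c + e^{iπ/4}t` crossing the real axis at `c`, traversed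
downward from the first quadrant to the third quadrant. -/
noncomputable def siegelJ (q : ℝ) (ξ : ℂ) (c : ℝ) : ℂ :=
  -(Complex.exp (I * (π : ℂ) / 4) *
    ∫ t : ℝ,
      Complex.exp (I * (π : ℂ) * (q : ℂ)
          * (((c : ℂ) + Complex.exp (I * (π : ℂ) / 4) * (t : ℂ)) - ξ) ^ 2) /
        (1 - Complex.exp (-(2 * (π : ℂ) * I
            * ((c : ℂ) + Complex.exp (I * (π : ℂ) / 4) * (t : ℂ))))))

theorem intervalIntegral_inv_add_mul_I {b : ℝ} (hb : b ≠ 0) (T : ℝ) :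
    ∫ t in (-T)..T, ((t : ℂ) + b * I)⁻¹ = -(2 * Real.arctan (T / b) : ℝ) * I := by
  have hne (t : ℝ) : (t : ℂ) + b * I ≠ 0 := fun h => hb (by simpa using congrArg Complex.im h)
  have hpos (t : ℝ) : t ^ 2 + b ^ 2 ≠ 0 := by positivity
  have hderiv (t : ℝ) : HasDerivAt
      (fun t : ℝ => ((Real.log (t ^ 2 + b ^ 2) / 2 : ℝ) : ℂ) - (Real.arctan (t / b) : ℝ) * I)
      ((t : ℂ) + b * I)⁻¹ t := by
    have h1 : HasDerivAt (fun t : ℝ => Real.log (t ^ 2 + b ^ 2) / 2) (t / (t ^ 2 + b ^ 2)) t :=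
      ((((hasDerivAt_pow 2 t).add_const (b ^ 2)).log (hpos t)).div_const 2).congr_deriv (by
        norm_num
        field_simp)
    have h2 : HasDerivAt (fun t : ℝ => Real.arctan (t / b)) (b / (t ^ 2 + b ^ 2)) t :=
      ((hasDerivAt_id' t).div_const b).arctan.congr_deriv (by
        have := hpos t
        have : b ^ 2 + t ^ 2 ≠ 0 := by rwa [add_comm]
        field_simp
        ring)
    refine (h1.ofReal_comp.sub (h2.ofReal_comp.mul_const I)).congr_deriv ?_
    have h3 : (t : ℂ) ^ 2 + (b : ℂ) ^ 2 ≠ 0 := by exact_mod_cast hpos t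
    rw [← mul_eq_one_iff_eq_inv₀ (hne t)]
    push_cast
    field_simp
    linear_combination (-(b : ℂ) ^ 2) * Complex.I_sq
  rw [intervalIntegral.integral_eq_sub_of_hasDerivAt (fun t _ => hderiv t)]
  · rw [neg_div, Real.arctan_neg]
    push_cast
    ring_nf
  · exact (Continuous.inv₀ (by fun_prop) hne).intervalIntegrable _ _

theorem tendsto_intervalIntegral_inv_add_mul_I_of_pos {b : ℝ} (hb : 0 < b) :
    Filter.Tendsto (fun T : ℝ => ∫ t in (-T)..T, ((t : ℂ) + b * I)⁻¹) Filter.atTop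
      (nhds (-(π * I))) := by
  simp_rw [intervalIntegral_inv_add_mul_I hb.ne']
  have h := (Real.tendsto_arctan_atTop.mono_right nhdsWithin_le_nhds).comp
    (Filter.tendsto_id.atTop_div_const hb)
  have h' := ((Complex.continuous_ofReal.tendsto _).comp (h.const_mul 2)).neg.mul_const I
  rw [mul_div_cancel₀ π two_ne_zero, neg_mul] at h'
  refine h'.congr fun T => ?_
  simp

theorem tendsto_intervalIntegral_inv_add_mul_I_of_neg {b : ℝ} (hb : b < 0) :
    Filter.Tendsto (fun T : ℝ => ∫ t in (-T)..T, ((t : ℂ) + b * I)⁻¹) Filter.atTop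
      (nhds (π * I)) := by
  convert (tendsto_intervalIntegral_inv_add_mul_I_of_pos (neg_pos.2 hb)).neg using 2 with T
  · rw [intervalIntegral_inv_add_mul_I hb.ne, intervalIntegral_inv_add_mul_I (neg_pos.2 hb).ne',
      div_neg, Real.arctan_neg]
    push_cast
    ring
  · ring

/-- Residue theorem for a horizontal strip: the integrals of `P z / z` along the lines
`im z = b₂ < 0` and `im z = b₁ > 0` differ by the residue at the origin. -/
theorem integral_horizontal_sub_of_simple_pole {P : ℂ → ℂ} {U : Set ℂ} (hU : IsOpen U)
    (hP : DifferentiableOn ℂ P U) {b₁ b₂ : ℝ} (hb₁ : 0 < b₁) (hb₂ : b₂ < 0)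
    (hsub : ∀ z : ℂ, z.im ∈ Icc b₂ b₁ → z ∈ U)
    (hint₁ : MeasureTheory.Integrable fun t : ℝ => P (t + b₁ * I) / (t + b₁ * I))
    (hint₂ : MeasureTheory.Integrable fun t : ℝ => P (t + b₂ * I) / (t + b₂ * I))
    {ε : ℝ → ℝ} (hε : Filter.Tendsto ε Filter.atTop (nhds 0)) {T₀ : ℝ}
    (hbound : ∀ T y : ℝ, T₀ ≤ |T| → y ∈ Icc b₂ b₁ → ‖P (T + y * I) / (T + y * I)‖ ≤ ε |T|) :
    (∫ t : ℝ, P (t + b₂ * I) / (t + b₂ * I)) - ∫ t : ℝ, P (t + b₁ * I) / (t + b₁ * I)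
      = 2 * π * I * P 0 := by
  have h0 : (0 : ℂ) ∈ U := hsub 0 ⟨by simpa using hb₂.le, by simpa using hb₁.le⟩
  have hH : DifferentiableOn ℂ (dslope P 0) U :=
    (Complex.differentiableOn_dslope (hU.mem_nhds h0)).2 hP
  have hHeq {z : ℂ} (hz : z ≠ 0) : dslope P 0 z = P z / z - P 0 * z⁻¹ := by
    rw [dslope_of_ne _ hz, slope_def_field]
    field_simp
    ring
  have hline {b c : ℝ} (hb : b ≠ 0)
      (hint : MeasureTheory.Integrable fun t : ℝ => P (t + b * I) / (t + b * I))
      (hlim : Filter.Tendsto (fun T : ℝ => ∫ t in (-T)..T, ((t : ℂ) + b * I)⁻¹) Filter.atTop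
        (nhds (c * I))) :
      Filter.Tendsto (fun T : ℝ => ∫ t in (-T)..T, dslope P 0 (t + b * I)) Filter.atTop
        (nhds ((∫ t : ℝ, P (t + b * I) / (t + b * I)) - P 0 * (c * I))) := by
    have hne (t : ℝ) : (t : ℂ) + b * I ≠ 0 := fun h => hb (by simpa using congrArg Complex.im h)
    refine ((MeasureTheory.intervalIntegral_tendsto_integral hint Filter.tendsto_neg_atTop_atBot
      Filter.tendsto_id).sub (hlim.const_mul (P 0))).congr fun T => ?_
    simp_rw [hHeq (hne _)]
    rw [intervalIntegral.integral_sub hint.intervalIntegrable,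
      intervalIntegral.integral_const_mul]
    · rfl
    · exact (continuous_const.mul (Continuous.inv₀ (by fun_prop) hne)).intervalIntegrable _ _
  have hside {σ : ℝ} (hσ : |σ| = 1) :
      Filter.Tendsto (fun T : ℝ => ∫ y in b₂..b₁, dslope P 0 ((σ * T : ℝ) + y * I))
        Filter.atTop (nhds 0) := by
    have hlim : Filter.Tendsto (fun T : ℝ => (ε T + ‖P 0‖ * T⁻¹) * |b₁ - b₂|) Filter.atTop
        (nhds 0) := by
      simpa using (hε.add (tendsto_inv_atTop_zero.const_mul ‖P 0‖)).mul_const |b₁ - b₂|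
    refine squeeze_zero_norm' ?_ hlim
    filter_upwards [Filter.eventually_gt_atTop 0, Filter.eventually_ge_atTop T₀] with T hT hT₀
    refine intervalIntegral.norm_integral_le_of_norm_le_const fun y hy => ?_
    rw [uIoc_of_le (by linarith)] at hy
    have habs : |σ * T| = T := by rw [abs_mul, hσ, one_mul, abs_of_pos hT]
    have hre : T ≤ ‖((σ * T : ℝ) : ℂ) + y * I‖ := by
      have hre_eq : (((σ * T : ℝ) : ℂ) + y * I).re = σ * T := by simp
      simpa only [hre_eq, habs] using Complex.abs_re_le_norm (((σ * T : ℝ) : ℂ) + y * I)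
    have hne : ((σ * T : ℝ) : ℂ) + y * I ≠ 0 := norm_pos_iff.1 (hT.trans_le hre)
    rw [hHeq hne]
    refine (norm_sub_le _ _).trans (add_le_add ?_ ?_)
    · simpa only [habs] using hbound (σ * T) y (by rwa [habs]) ⟨hy.1.le, hy.2⟩
    · rw [norm_mul, norm_inv]
      gcongr
  have hrect (T : ℝ) := Complex.integral_boundary_rect_eq_zero_of_differentiableOn (dslope P 0)
    ⟨-T, b₂⟩ ⟨T, b₁⟩ (hH.mono fun z hz => hsub z (by
      have := hz.2
      rwa [mem_preimage, uIcc_of_le (by simpa using (hb₂.trans hb₁).le)] at this))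
  have h₂ := hline hb₂.ne hint₂ (tendsto_intervalIntegral_inv_add_mul_I_of_neg hb₂)
  have h₁ := hline (c := -π) hb₁.ne' hint₁
    (by simpa using tendsto_intervalIntegral_inv_add_mul_I_of_pos hb₁)
  have hr := (hside (σ := 1) (by simp)).const_smul I
  have hl := (hside (σ := -1) (by simp)).const_smul I
  have hzero := tendsto_nhds_unique (((h₂.sub h₁).add hr).sub hl)
    (tendsto_const_nhds.congr fun T => by
      simp only [neg_one_mul, one_mul]
      exact (hrect T).symm)
  push_cast at hzero
  simp only [smul_zero] at hzero
  linear_combination hzero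

theorem exp_I_mul_pi_div_four :
    Complex.exp (I * (π : ℂ) / 4) = (√2 / 2 : ℝ) * (1 + I) := by
  have h : I * (π : ℂ) / 4 = (π / 4 : ℝ) * I := by push_cast; ring
  rw [h, Complex.exp_mul_I, ← Complex.ofReal_cos, ← Complex.ofReal_sin, Real.cos_pi_div_four,
    Real.sin_pi_div_four]
  ring

theorem exp_I_mul_pi_div_four_mul_re (z : ℂ) :
    (Complex.exp (I * (π : ℂ) / 4) * z).re = √2 / 2 * (z.re - z.im) := by
  rw [exp_I_mul_pi_div_four]
  simp only [Complex.mul_re, Complex.mul_im, Complex.add_re, Complex.add_im, Complex.one_re,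
    Complex.one_im, Complex.I_re, Complex.I_im, Complex.ofReal_re, Complex.ofReal_im]
  ring

theorem exp_I_mul_pi_div_four_mul_im (z : ℂ) :
    (Complex.exp (I * (π : ℂ) / 4) * z).im = √2 / 2 * (z.re + z.im) := by
  rw [exp_I_mul_pi_div_four]
  simp only [Complex.mul_re, Complex.mul_im, Complex.add_re, Complex.add_im, Complex.one_re,
    Complex.one_im, Complex.I_re, Complex.I_im, Complex.ofReal_re, Complex.ofReal_im]
  ring

theorem exp_I_mul_pi_div_four_sq : Complex.exp (I * (π : ℂ) / 4) ^ 2 = I := by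
  rw [← Complex.exp_nat_mul]
  convert Complex.exp_pi_div_two_mul_I using 2
  push_cast
  ring

theorem norm_exp_I_mul_pi_div_four : ‖Complex.exp (I * (π : ℂ) / 4)‖ = 1 := by
  rw [Complex.norm_exp]
  simp

/-- The integrand of `siegelJ` as a function of the rotated variable `e^{-iπ/4}x`, including the
factor `dx`. -/
noncomputable def siegelRotated (q : ℝ) (ξ z : ℂ) : ℂ :=
  Complex.exp (I * (π : ℂ) / 4) *
    (Complex.exp (I * (π : ℂ) * (q : ℂ) * (Complex.exp (I * (π : ℂ) / 4) * z - ξ) ^ 2) /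
      (1 - Complex.exp (-(2 * (π : ℂ) * I * (Complex.exp (I * (π : ℂ) / 4) * z)))))

theorem siegelJ_eq_neg_integral_siegelRotated (q : ℝ) (ξ : ℂ) (c : ℝ) :
    siegelJ q ξ c = -∫ t : ℝ, siegelRotated q ξ (t + (-(c * (√2 / 2)) : ℝ) * I) := by
  have hx (t : ℝ) : (c : ℂ) + Complex.exp (I * (π : ℂ) / 4) * t =
      Complex.exp (I * (π : ℂ) / 4) *
        ((t + c * (√2 / 2) : ℝ) + (-(c * (√2 / 2)) : ℝ) * I) := by
    have h2 : √2 / 2 * (√2 / 2) * 2 = (1 : ℝ) := by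
      nlinarith [Real.mul_self_sqrt (show (0 : ℝ) ≤ 2 by norm_num)]
    apply Complex.ext
    · rw [Complex.add_re, exp_I_mul_pi_div_four_mul_re, exp_I_mul_pi_div_four_mul_re]
      simp
      linear_combination (-c) * h2
    · rw [Complex.add_im, exp_I_mul_pi_div_four_mul_im, exp_I_mul_pi_div_four_mul_im]
      simp
  rw [siegelJ, ← MeasureTheory.integral_const_mul,
    ← MeasureTheory.integral_add_right_eq_self
      (fun t : ℝ => siegelRotated q ξ (t + (-(c * (√2 / 2)) : ℝ) * I)) (c * (√2 / 2))]
  simp only [siegelRotated, hx]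

theorem norm_siegelRotated_le {q : ℝ} (hq : 0 < q) (ξ : ℂ) {T y : ℝ} (hT : 2 ≤ |T|)
    (hy : |y| ≤ 1) :
    ‖siegelRotated q ξ (T + y * I)‖ ≤
      2 * rexp (π * q * (1 + 2 * ‖ξ‖ + 3 * ‖ξ‖ ^ 2)) * rexp (-(π * q / 2) * T ^ 2) := by
  set z : ℂ := T + y * I with hz
  set ω := Complex.exp (I * (π : ℂ) / 4) with hω
  have hzre : z.re = T := by simp [hz]
  have hzim : z.im = y := by simp [hz]
  have hznorm : ‖z‖ ≤ |T| + 1 := by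
    have := Complex.norm_le_abs_re_add_abs_im z
    rw [hzre, hzim] at this
    linarith
  have hexponent : (I * (ω * z - ξ) ^ 2).re ≤
      1 + 2 * ‖ξ‖ + 3 * ‖ξ‖ ^ 2 - T ^ 2 / 2 := by
    have hexpand : I * (ω * z - ξ) ^ 2 = -z ^ 2 + I * (ξ ^ 2 - 2 * ω * z * ξ) := by
      linear_combination I * z ^ 2 * exp_I_mul_pi_div_four_sq + z ^ 2 * Complex.I_sq
    have hsq : (-z ^ 2).re = y ^ 2 - T ^ 2 := by
      rw [Complex.neg_re, sq, Complex.mul_re, hzre, hzim]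
      ring
    have hrest : (I * (ξ ^ 2 - 2 * ω * z * ξ)).re ≤ ‖ξ‖ ^ 2 + 2 * ‖z‖ * ‖ξ‖ := by
      refine (Complex.re_le_norm _).trans ?_
      rw [norm_mul, Complex.norm_I, one_mul]
      refine (norm_sub_le _ _).trans ?_
      simp [hω, norm_exp_I_mul_pi_div_four]
    rw [hexpand, Complex.add_re, hsq]
    have := mul_le_mul_of_nonneg_right hznorm (norm_nonneg ξ)
    nlinarith [sq_nonneg (|T| - 2 * ‖ξ‖), sq_abs T, sq_abs y, abs_nonneg y]
  have hnum : ‖Complex.exp (I * (π : ℂ) * (q : ℂ) * (ω * z - ξ) ^ 2)‖ ≤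
      rexp (π * q * (1 + 2 * ‖ξ‖ + 3 * ‖ξ‖ ^ 2)) * rexp (-(π * q / 2) * T ^ 2) := by
    have hre : (I * (π : ℂ) * (q : ℂ) * (ω * z - ξ) ^ 2).re =
        π * q * (I * (ω * z - ξ) ^ 2).re := by
      rw [← Complex.re_ofReal_mul]
      push_cast
      ring_nf
    rw [Complex.norm_exp, hre, ← Real.exp_add, Real.exp_le_exp]
    have := mul_le_mul_of_nonneg_left hexponent (mul_pos Real.pi_pos hq).le
    linarith
  have hden : 1 / 2 ≤ ‖1 - Complex.exp (-(2 * (π : ℂ) * I * (ω * z)))‖ := by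
    have hre : (-(2 * (π : ℂ) * I * (ω * z))).re = √2 * π * (T + y) := by
      have : (-(2 * (π : ℂ) * I * (ω * z))) = (2 * π : ℝ) * -(I * (ω * z)) := by
        push_cast
        ring
      rw [this, Complex.re_ofReal_mul, Complex.neg_re, Complex.I_mul_re, neg_neg,
        exp_I_mul_pi_div_four_mul_im, hzre, hzim]
      ring
    have hcoef : 1 ≤ √2 * π := by
      have : (1 : ℝ) ≤ √2 := Real.one_le_sqrt.2 (by norm_num)
      nlinarith [Real.pi_gt_three]
    have hnorm := Complex.norm_exp (-(2 * (π : ℂ) * I * (ω * z)))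
    rw [hre] at hnorm
    obtain ⟨hy₁, hy₂⟩ := abs_le.1 hy
    rcases le_abs'.1 hT with h | h
    · have hle : rexp (√2 * π * (T + y)) ≤ 1 / 2 := by
        have h1 : √2 * π * (T + y) ≤ -1 := by nlinarith
        have h2 : 2 ≤ rexp 1 := by linarith [Real.add_one_le_exp 1]
        calc rexp (√2 * π * (T + y)) ≤ rexp (-1) := Real.exp_le_exp.2 h1
          _ = (rexp 1)⁻¹ := Real.exp_neg 1
          _ ≤ 2⁻¹ := inv_anti₀ two_pos h2
          _ = 1 / 2 := by norm_num
      have := norm_sub_norm_le 1 (Complex.exp (-(2 * (π : ℂ) * I * (ω * z))))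
      rw [norm_one] at this
      linarith
    · have h1 : 1 ≤ √2 * π * (T + y) := by nlinarith
      have h2 := Real.add_one_le_exp (√2 * π * (T + y))
      have := norm_sub_norm_le (Complex.exp (-(2 * (π : ℂ) * I * (ω * z)))) 1
      rw [norm_one, norm_sub_rev] at this
      linarith
  rw [siegelRotated, norm_mul, norm_exp_I_mul_pi_div_four, one_mul, norm_div,
    div_le_iff₀ (by linarith)]
  refine hnum.trans ?_
  have hpos : 0 ≤ rexp (π * q * (1 + 2 * ‖ξ‖ + 3 * ‖ξ‖ ^ 2)) * rexp (-(π * q / 2) * T ^ 2) := by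
    positivity
  nlinarith

theorem one_sub_exp_rotated_ne_zero {z : ℂ} (hz : z ≠ 0) (him : |z.im| < √2 / 2) :
    1 - Complex.exp (-(2 * (π : ℂ) * I * (Complex.exp (I * (π : ℂ) / 4) * z))) ≠ 0 := by
  intro h
  obtain ⟨n, hn⟩ := Complex.exp_eq_one_iff.1 (sub_eq_zero.1 h).symm
  have hzn : Complex.exp (I * (π : ℂ) / 4) * z = ((-n : ℝ) : ℂ) := by
    apply mul_left_cancel₀ Complex.two_pi_I_ne_zero
    push_cast
    linear_combination -hn
  have hre := congrArg Complex.re hzn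
  have him' := congrArg Complex.im hzn
  rw [exp_I_mul_pi_div_four_mul_re, Complex.ofReal_re] at hre
  rw [exp_I_mul_pi_div_four_mul_im, Complex.ofReal_im] at him'
  have hs2 : √2 * √2 = (2 : ℝ) := Real.mul_self_sqrt (by norm_num)
  have hny : (n : ℝ) = √2 * z.im := by linear_combination hre - him'
  have hlt : |(n : ℝ)| < 1 := by
    rw [hny, abs_mul, abs_of_pos (by positivity)]
    nlinarith [mul_lt_mul_of_pos_left him (show (0 : ℝ) < √2 by positivity)]
  have hn0 : n = 0 := Int.abs_lt_one_iff.1 (by exact_mod_cast hlt)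
  rw [hn0] at hzn
  exact hz ((mul_eq_zero.1 (hzn.trans (by simp))).resolve_left (Complex.exp_ne_zero _))

theorem integrable_siegelRotated {q : ℝ} (hq : 0 < q) (ξ : ℂ) {b : ℝ} (hb : b ≠ 0)
    (hb' : |b| < √2 / 2) :
    MeasureTheory.Integrable fun t : ℝ => siegelRotated q ξ (t + b * I) := by
  have hcont : Continuous fun t : ℝ => siegelRotated q ξ (t + b * I) := by
    unfold siegelRotated
    refine continuous_const.mul (Continuous.div (by fun_prop) (by fun_prop) fun t => ?_)
    refine one_sub_exp_rotated_ne_zero (fun h => hb ?_) (by simpa using hb')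
    simpa using congrArg Complex.im h
  have hb1 : |b| ≤ 1 := by
    nlinarith [Real.sqrt_nonneg 2, Real.mul_self_sqrt (show (0 : ℝ) ≤ 2 by norm_num)]
  refine hcont.locallyIntegrable.integrable_of_isBigO_cocompact
    (g := fun t : ℝ => rexp (-(π * q / 2) * t ^ 2)) ?_
    ((integrable_exp_neg_mul_sq (by positivity)).integrableAtFilter _)
  refine Asymptotics.IsBigO.of_bound
    (2 * rexp (π * q * (1 + 2 * ‖ξ‖ + 3 * ‖ξ‖ ^ 2))) ?_
  filter_upwards [(tendsto_norm_cocompact_atTop (E := ℝ)).eventually_ge_atTop 2] with t ht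
  simpa using norm_siegelRotated_le hq ξ ht hb1

theorem integral_siegelRotated_sub {q : ℝ} (hq : 0 < q) (ξ : ℂ) {b₁ b₂ : ℝ}
    (hb₁ : b₁ ∈ Ioo 0 (√2 / 2)) (hb₂ : b₂ ∈ Ioo (-(√2 / 2)) 0) :
    (∫ t : ℝ, siegelRotated q ξ (t + b₂ * I)) - ∫ t : ℝ, siegelRotated q ξ (t + b₁ * I)
      = Complex.exp (I * (π : ℂ) * (q : ℂ) * ξ ^ 2) := by
  set ω := Complex.exp (I * (π : ℂ) / 4) with hω
  set D : ℂ → ℂ := fun z => 1 - Complex.exp (-(2 * (π : ℂ) * I * (ω * z))) with hD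
  set P : ℂ → ℂ := fun z =>
    ω * (Complex.exp (I * (π : ℂ) * (q : ℂ) * (ω * z - ξ) ^ 2) / dslope D 0 z) with hPdef
  set U : Set ℂ := {z | |z.im| < √2 / 2}
  have hω0 : ω ≠ 0 := Complex.exp_ne_zero _
  have hD0 : D 0 = 0 := by simp [hD]
  have hderiv : deriv D 0 = 2 * π * I * ω := by
    have h := (((hasDerivAt_id' (0 : ℂ)).const_mul ω).const_mul (2 * (π : ℂ) * I)).neg.cexp
      |>.const_sub 1
    refine h.deriv.trans ?_
    simp
  have hdslope {z : ℂ} (hz : z ≠ 0) : dslope D 0 z = D z / z := by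
    rw [dslope_of_ne _ hz, slope_def_field, hD0, sub_zero, sub_zero]
  have hdslope_ne (z : ℂ) (hz : z ∈ U) : dslope D 0 z ≠ 0 := by
    rcases eq_or_ne z 0 with rfl | h0
    · rw [dslope_same, hderiv]
      exact mul_ne_zero Complex.two_pi_I_ne_zero hω0
    · rw [hdslope h0]
      exact div_ne_zero (one_sub_exp_rotated_ne_zero h0 hz) h0
  have hPz {z : ℂ} (hz : z ≠ 0) : P z / z = siegelRotated q ξ z := by
    simp only [hPdef, siegelRotated, hdslope hz]
    rw [div_div_eq_mul_div, ← mul_div_assoc, ← mul_div_assoc, div_right_comm, ← mul_assoc,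
      mul_div_cancel_right₀ _ hz, mul_div_assoc]
  have hUopen : IsOpen U := isOpen_lt (by fun_prop) continuous_const
  have hP : DifferentiableOn ℂ P U := by
    have hdiff : DifferentiableOn ℂ (dslope D 0) U :=
      (Complex.differentiableOn_dslope (hUopen.mem_nhds (by simp [U]))).2
        (by fun_prop)
    exact (DifferentiableOn.div (by fun_prop) hdiff hdslope_ne).const_mul ω
  have hne {b : ℝ} (hb : b ≠ 0) (t : ℝ) : (t : ℂ) + b * I ≠ 0 :=
    fun h => hb (by simpa using congrArg Complex.im h)
  have hsqrt : √2 / 2 ≤ (1 : ℝ) := by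
    nlinarith [Real.sqrt_nonneg 2, Real.mul_self_sqrt (show (0 : ℝ) ≤ 2 by norm_num)]
  have hstrip {y : ℝ} (hy : y ∈ Icc b₂ b₁) : |y| < √2 / 2 :=
    abs_lt.2 ⟨by linarith [hb₂.1, hy.1], by linarith [hb₁.2, hy.2]⟩
  have hle : b₂ ≤ b₁ := (hb₂.2.trans hb₁.1).le
  have hε : Filter.Tendsto (fun T : ℝ => 2 * rexp (π * q * (1 + 2 * ‖ξ‖ + 3 * ‖ξ‖ ^ 2)) *
      rexp (-(π * q / 2) * T ^ 2)) Filter.atTop (nhds 0) := by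
    have h := (Filter.tendsto_pow_atTop (α := ℝ) two_ne_zero).const_mul_atTop_of_neg
      (show -(π * q / 2) < 0 by have := Real.pi_pos; simp; positivity)
    simpa using (Real.tendsto_exp_atBot.comp h).const_mul
      (2 * rexp (π * q * (1 + 2 * ‖ξ‖ + 3 * ‖ξ‖ ^ 2)))
  have hmain := integral_horizontal_sub_of_simple_pole hUopen hP hb₁.1 hb₂.2
    (fun z hz => hstrip hz)
    (by simpa only [hPz (hne hb₁.1.ne' _)] using
      integrable_siegelRotated hq ξ hb₁.1.ne' (hstrip ⟨hle, le_rfl⟩))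
    (by simpa only [hPz (hne hb₂.2.ne _)] using
      integrable_siegelRotated hq ξ hb₂.2.ne (hstrip ⟨le_rfl, hle⟩))
    hε (T₀ := 2) (fun T y hT hy => by
      have hT0 : (T : ℂ) + y * I ≠ 0 := fun h => by
        have : T = 0 := by simpa using congrArg Complex.re h
        norm_num [this] at hT
      rw [hPz hT0, sq_abs]
      exact norm_siegelRotated_le hq ξ hT ((hstrip hy).le.trans hsqrt))
  simp only [hPz (hne hb₁.1.ne' _), hPz (hne hb₂.2.ne _)] at hmain
  rw [hmain]
  have hπI := Complex.two_pi_I_ne_zero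
  simp only [hPdef, dslope_same, hderiv, mul_zero, zero_sub, neg_sq]
  field_simp

/-- **Residue picked up when the contour crosses the pole at `x = 0`**: for every
real `q > 0`, `ξ ∈ ℂ`, `c₁ ∈ (-1,0)` and `c₂ ∈ (0,1)`,
`J(c₁) = J(c₂) + e^{iπqξ²}`. -/
theorem siegelJ_contour_shift (q : ℝ) (hq : 0 < q) (ξ : ℂ) (c₁ c₂ : ℝ)
    (hc₁ : c₁ ∈ Ioo (-1 : ℝ) 0) (hc₂ : c₂ ∈ Ioo (0 : ℝ) 1) :
    siegelJ q ξ c₁ = siegelJ q ξ c₂ + Complex.exp (I * (π : ℂ) * (q : ℂ) * ξ ^ 2) := by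
  rw [siegelJ_eq_neg_integral_siegelRotated, siegelJ_eq_neg_integral_siegelRotated,
    ← integral_siegelRotated_sub hq ξ (b₁ := -(c₁ * (√2 / 2))) (b₂ := -(c₂ * (√2 / 2)))]
  · ring
  · have hs : (0 : ℝ) < √2 / 2 := by positivity
    constructor <;> nlinarith [hc₁.1, hc₁.2]
  · have hs : (0 : ℝ) < √2 / 2 := by positivity
    constructor <;> nlinarith [hc₂.1, hc₂.2]
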